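/- For every natural number m there exists a nonzero polynomial P ∈ ℂ[x] of degree m such that x·P'' + 4·x·P' = 4·m·P (formal polynomial derivatives). Equivalently (and as a consequence), for every natural number m there is a nonzero polynomial P of degree m such that the entire function y(x) = e^{2x}·P(x) satisfies x·y''(x) = (4x + 4m)·y(x) for all x ∈ ℂ; that is, the operator L₂ = (d/dx)² − 4 − 4μ/x admits the exponential solution e^{2x}P_μ(x) with deg P_μ = μ when the parameter μ is a nonnegative integer. -/

import Mathlib

open Polynomial

/-- The coefficient of `x ^ (k + 1)` in the degree `n + 1` polynomial solution of `stmt_12`,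
normalized so that the coefficient of `x` is `1`. -/
noncomputable def expSolutionCoeff (n k : ℕ) : ℂ :=
  4 ^ k * (n.choose k : ℂ) / ((k + 1).factorial : ℂ)

lemma expSolutionCoeff_succ (n k : ℕ) :
    ((k : ℂ) + 1) * (k + 2) * expSolutionCoeff n (k + 1)
      = 4 * ((n : ℂ) - k) * expSolutionCoeff n k := by
  have hchoose : (n.choose (k + 1) : ℂ) * (k + 1) = n.choose k * ((n : ℂ) - k) := by
    rcases le_or_gt k n with hk | hk
    · have := Nat.choose_succ_right_eq n k
      rw [← Nat.cast_sub hk]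
      exact_mod_cast this
    · simp [Nat.choose_eq_zero_of_lt hk, Nat.choose_eq_zero_of_lt (hk.trans k.lt_succ_self)]
  have hfact : ((k + 1).factorial : ℂ) ≠ 0 := by exact_mod_cast (k + 1).factorial_ne_zero
  have hk : (k : ℂ) + 2 ≠ 0 := by exact_mod_cast (k + 1).succ_ne_zero
  have hsucc : ((k + 1 + 1).factorial : ℂ) = (k + 2) * (k + 1).factorial := by
    rw [Nat.factorial_succ (k + 1)]
    push_cast
    ring
  unfold expSolutionCoeff
  rw [hsucc]
  field_simp
  linear_combination 4 * (4 : ℂ) ^ k * hchoose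

lemma exists_polynomial_solution (m : ℕ) :
    ∃ P : Polynomial ℂ, P ≠ 0 ∧ P.natDegree = m ∧
      X * derivative (derivative P) + 4 * X * derivative P = C (4 * (m : ℂ)) * P := by
  rcases m with _ | n
  · exact ⟨1, one_ne_zero, natDegree_one, by simp⟩
  set Q : Polynomial ℂ := ∑ k ∈ Finset.range (n + 1), C (expSolutionCoeff n k) * X ^ k with hQ
  have hcoeff (k : ℕ) : Q.coeff k = expSolutionCoeff n k := by
    rw [hQ, finsetSum_coeff]
    simp only [coeff_C_mul_X_pow, Finset.sum_ite_eq, Finset.mem_range]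
    split_ifs with hk
    · rfl
    · simp [expSolutionCoeff, Nat.choose_eq_zero_of_lt (show n < k by lia)]
  have hlead : Q.coeff n ≠ 0 := by
    simp [hcoeff, expSolutionCoeff, Nat.factorial_ne_zero]
  have hQ0 : Q ≠ 0 := fun h => hlead (by simp [h])
  have hdeg : Q.natDegree = n := by
    refine le_antisymm (natDegree_le_iff_coeff_eq_zero.2 fun k hk => ?_)
      (le_natDegree_of_ne_zero hlead)
    simp [hcoeff, expSolutionCoeff, Nat.choose_eq_zero_of_lt hk]
  refine ⟨X * Q, mul_ne_zero X_ne_zero hQ0, by rw [natDegree_X_mul hQ0, hdeg], ?_⟩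
  have h4 : (4 : Polynomial ℂ) = C 4 := (map_ofNat C 4).symm
  ext j
  rw [h4, mul_assoc, coeff_add, coeff_C_mul, coeff_C_mul]
  rcases j with _ | k
  · simp
  · have := expSolutionCoeff_succ n k
    simp only [coeff_X_mul, coeff_derivative, hcoeff]
    push_cast
    linear_combination this

lemma hasDerivAt_exp_two_mul_mul_eval (P : Polynomial ℂ) (x : ℂ) :
    HasDerivAt (fun z : ℂ => Complex.exp (2 * z) * P.eval z)
      (Complex.exp (2 * x) * (C 2 * P + derivative P).eval x) x := by
  have hexp : HasDerivAt (fun z : ℂ => Complex.exp (2 * z)) (Complex.exp (2 * x) * (2 * 1)) x :=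
    ((hasDerivAt_id x).const_mul 2).cexp
  refine (hexp.mul (P.hasDerivAt x)).congr_deriv ?_
  simp only [eval_add, eval_mul, eval_C]
  ring

lemma iteratedDeriv_two_exp_two_mul_mul_eval (P : Polynomial ℂ) (x : ℂ) :
    iteratedDeriv 2 (fun z : ℂ => Complex.exp (2 * z) * P.eval z) x
      = Complex.exp (2 * x) *
        (4 * P.eval x + 4 * (derivative P).eval x + (derivative (derivative P)).eval x) := by
  have hderiv (R : Polynomial ℂ) : deriv (fun z : ℂ => Complex.exp (2 * z) * R.eval z)
      = fun z => Complex.exp (2 * z) * (C 2 * R + derivative R).eval z :=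
    funext fun z => (hasDerivAt_exp_two_mul_mul_eval R z).deriv
  rw [iteratedDeriv_succ, iteratedDeriv_one, hderiv, hderiv]
  simp only [derivative_add, derivative_C_mul, eval_add, eval_mul, eval_C]
  ring

/-- For every `m ∈ ℕ`, there is a nonzero polynomial `P ∈ ℂ[x]` of degree `m` with
`x P'' + 4x P' = 4m P`; consequently `y(x) = e^{2x} P(x)` satisfies `x y'' = (4x + 4m) y`,
i.e. the operator `L₂ = ∂² − 4 − 4μ/x` has the exponential solution `e^{2x} P_μ(x)` with
`deg P_μ = μ` when `μ = m` is a nonnegative integer. -/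
theorem stmt_12 (m : ℕ) :
    ∃ P : Polynomial ℂ, P ≠ 0 ∧ P.natDegree = m ∧
      X * derivative (derivative P) + 4 * X * derivative P = C (4 * (m : ℂ)) * P ∧
      ∀ x : ℂ,
        x * iteratedDeriv 2 (fun z : ℂ => Complex.exp (2 * z) * P.eval z) x
          = (4 * x + 4 * (m : ℂ)) * (Complex.exp (2 * x) * P.eval x) := by
  obtain ⟨P, hP0, hdeg, hP⟩ := exists_polynomial_solution m
  refine ⟨P, hP0, hdeg, hP, fun x => ?_⟩
  have hx := congrArg (eval x) hP
  simp only [eval_add, eval_mul, eval_X, eval_C, eval_ofNat] at hx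
  rw [iteratedDeriv_two_exp_two_mul_mul_eval]
  linear_combination Complex.exp (2 * x) * hx
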